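/- arXiv:2411.09746 — 5 statements merged into one kernel-verified Lean document; each statement's English description precedes it below -/
import Mathlib

section
/- Let ι be a nonempty finite type with D := |ι|, let c : ι → ℂ satisfy Σ_n |c_n|² = 1, let K ≥ 0 and a : ι → ℂ satisfy |a_n| ≤ K for all n. Set m := (1/D)·Σ_n a_n, D_eff := (Σ_n |c_n|⁴)⁻¹, and for ε > 0 set Δ_ε := |{n ∈ ι : |a_n − m| > ε·K}| / D. Then |Σ_n |c_n|²·(a_n − m)| ≤ K·(ε + 2·√(D·Δ_ε / D_eff)). -/
open scoped BigOperators

open Finset in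
/-- The norm of the uniform average of a finite family is at most any bound on its members. -/
theorem norm_average_le {ι : Type*} [Fintype ι] [Nonempty ι] {K : ℝ} {a : ι → ℂ}
    (ha : ∀ n, ‖a n‖ ≤ K) : ‖(1 / (Fintype.card ι : ℂ)) * ∑ n, a n‖ ≤ K := by
  have hpos : (0 : ℝ) < Fintype.card ι := by exact_mod_cast Fintype.card_pos
  have hsum : ‖∑ n, a n‖ ≤ Fintype.card ι * K := by
    simpa using norm_sum_le_of_le univ fun n _ => ha n
  rw [norm_mul, norm_div, norm_one, Complex.norm_natCast, one_div, inv_mul_le_iff₀ hpos]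
  exact hsum

open Finset in
/-- Cauchy–Schwarz: the weight of a subset is controlled by its size and the sum of squares
of all weights. -/
theorem sum_le_sqrt_card_mul_sum_sq {ι : Type*} [Fintype ι] (p : ι → ℝ) (s : Finset ι) :
    ∑ n ∈ s, p n ≤ √(#s * ∑ n, p n ^ 2) := by
  apply Real.le_sqrt_of_sq_le
  calc (∑ n ∈ s, p n) ^ 2 ≤ #s * ∑ n ∈ s, p n ^ 2 := sq_sum_le_card_mul_sum_sq
    _ ≤ #s * ∑ n, p n ^ 2 := by
      gcongr
      exact subset_univ s

open Finset in
/-- A probability-weighted sum of vectors of norm at most `B`, all but those in `s` having norm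
at most `δ`, has norm at most `δ` plus `B` times the weight of `s`. -/
theorem norm_weighted_sum_le {ι : Type*} [Fintype ι] {p : ι → ℝ} (hp : ∀ n, 0 ≤ p n)
    (hp1 : ∑ n, p n = 1) {b : ι → ℂ} {B δ : ℝ} (hδ : 0 ≤ δ) (hb : ∀ n, ‖b n‖ ≤ B)
    (s : Finset ι) (hs : ∀ n ∉ s, ‖b n‖ ≤ δ) :
    ‖∑ n, (p n : ℂ) * b n‖ ≤ δ + B * ∑ n ∈ s, p n := by
  classical
  have hterm : ∀ n ∈ univ, ‖(p n : ℂ) * b n‖ ≤ p n * δ + if n ∈ s then B * p n else 0 := by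
    intro n _
    rw [norm_mul, Complex.norm_real, Real.norm_of_nonneg (hp n)]
    split_ifs with hn
    · nlinarith [mul_le_mul_of_nonneg_left (hb n) (hp n), mul_nonneg (hp n) hδ]
    · simpa using mul_le_mul_of_nonneg_left (hs n hn) (hp n)
  refine (norm_sum_le_of_le univ hterm).trans_eq ?_
  rw [sum_add_distrib, ← sum_mul, hp1, one_mul, sum_ite_mem, univ_inter, mul_sum]

/-- Thermalization inequality (Theorem 2.1): the deviation of the
`|c_n|²`-weighted average of `a_n` from the microcanonical mean `m` is controlled by
`ε` plus the fraction of ETH-violating indices. -/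
theorem stmt1 {ι : Type*} [Fintype ι] [Nonempty ι]
    (c : ι → ℂ) (hc : ∑ n, ‖c n‖ ^ 2 = 1)
    (K : ℝ) (hK : 0 ≤ K) (a : ι → ℂ) (ha : ∀ n, ‖a n‖ ≤ K)
    (ε : ℝ) (hε : 0 < ε)
    (D : ℝ) (hD : D = Fintype.card ι)
    (m : ℂ) (hm : m = (1 / (D : ℂ)) * ∑ n, a n)
    (Deff : ℝ) (hDeff : Deff = (∑ n, ‖c n‖ ^ 4)⁻¹)
    (Δ : ℝ) (hΔ : Δ = (Nat.card {n : ι // ε * K < ‖a n - m‖} : ℝ) / D) :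
    ‖∑ n, ((‖c n‖ ^ 2 : ℝ) : ℂ) * (a n - m)‖ ≤ K * (ε + 2 * Real.sqrt (D * Δ / Deff)) := by
  classical
  let s : Finset ι := {n | ε * K < ‖a n - m‖}
  have hcard : Nat.card {n : ι // ε * K < ‖a n - m‖} = s.card := by
    rw [Nat.card_eq_fintype_card, Fintype.card_subtype]
  have hD0 : D ≠ 0 := by
    rw [hD]
    exact_mod_cast Fintype.card_ne_zero
  have hmK : ‖m‖ ≤ K := by
    rw [hm, hD, Complex.ofReal_natCast]
    exact norm_average_le ha
  have hdev : ∀ n, ‖a n - m‖ ≤ 2 * K := fun n => by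
    linarith [norm_sub_le (a n) m, ha n]
  have hrad : D * Δ / Deff = s.card * ∑ n, (‖c n‖ ^ 2) ^ 2 := by
    rw [hΔ, hDeff, hcard, mul_div_cancel₀ _ hD0, div_inv_eq_mul]
    simp only [← pow_mul, Nat.reduceMul]
  have hweighted := norm_weighted_sum_le (p := fun n => ‖c n‖ ^ 2) (fun n => by positivity) hc
    (mul_nonneg hε.le hK) hdev s (fun n hn => by simpa [s] using hn)
  calc _ ≤ ε * K + 2 * K * ∑ n ∈ s, ‖c n‖ ^ 2 := hweighted
    _ ≤ ε * K + 2 * K * √(s.card * ∑ n, (‖c n‖ ^ 2) ^ 2) := by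
      gcongr
      exact sum_le_sqrt_card_mul_sum_sq _ s
    _ = K * (ε + 2 * √(D * Δ / Deff)) := by
      rw [hrad]
      ring
end

section
/- Let ι be a finite type with D := |ι| ≥ 2, let c : ι → ℂ satisfy Σ_n |c_n|² = 1, set D_eff := (Σ_n |c_n|⁴)⁻¹, let K ≥ 0 and b : ι × ι → ℂ satisfy |b(n,m)| ≤ √D·K for all n ≠ m. For ε > 0 set Δ'_ε := |{(n,m) : n ≠ m and |b(n,m)| > ε·K}| / (D·(D−1)). Then Σ_{n≠m} |c_n|²·|c_m|²·|b(n,m)|² ≤ K²·(ε² + (D²/D_eff)·√(Δ'_ε)). -/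
open scoped BigOperators

/-- Cauchy–Schwarz on a set of pairs: a product weight summed over `B ⊆ ι × ι` is at most
`√|B|` times the sum of the squared weights. -/
theorem sum_mul_le_sqrt_card_mul_sum_sq {ι : Type*} [Fintype ι] (p : ι → ℝ)
    (B : Finset (ι × ι)) :
    ∑ x ∈ B, p x.1 * p x.2 ≤ √(B.card : ℝ) * ∑ n, p n ^ 2 := by
  have hS : 0 ≤ ∑ n, p n ^ 2 := Finset.sum_nonneg fun n _ => sq_nonneg _
  have hsq : ∑ x ∈ B, (p x.1 * p x.2) ^ 2 ≤ (∑ n, p n ^ 2) ^ 2 := by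
    calc ∑ x ∈ B, (p x.1 * p x.2) ^ 2
        ≤ ∑ x : ι × ι, (p x.1 * p x.2) ^ 2 :=
          Finset.sum_le_sum_of_subset_of_nonneg (Finset.subset_univ B)
            fun x _ _ => sq_nonneg _
      _ = (∑ n, p n ^ 2) ^ 2 := by
          simp only [mul_pow]
          rw [sq (∑ n, p n ^ 2), Finset.sum_mul_sum, Fintype.sum_prod_type]
  refine abs_le_of_sq_le_sq' ?_ (by positivity) |>.2
  rw [mul_pow, Real.sq_sqrt (Nat.cast_nonneg _)]
  exact sq_sum_le_card_mul_sum_sq.trans (mul_le_mul_of_nonneg_left hsq (Nat.cast_nonneg _))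

/-- Equilibration inequality (Theorem 2.2): the long-time variance
`Σ_{n≠m} |c_n|²|c_m|²|b(n,m)|²` is bounded by `K²(ε² + (D²/D_eff)√Δ'_ε)`. -/
theorem stmt3 {ι : Type*} [Fintype ι] [DecidableEq ι] (hcard : 2 ≤ Fintype.card ι)
    (c : ι → ℂ) (hc : ∑ n, ‖c n‖ ^ 2 = 1)
    (K : ℝ) (hK : 0 ≤ K) (b : ι → ι → ℂ)
    (hb : ∀ n m : ι, n ≠ m → ‖b n m‖ ≤ Real.sqrt (Fintype.card ι) * K)
    (ε : ℝ) (hε : 0 < ε)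
    (D : ℝ) (hD : D = Fintype.card ι)
    (Deff : ℝ) (hDeff : Deff = (∑ n, ‖c n‖ ^ 4)⁻¹)
    (Δ : ℝ) (hΔ : Δ = (Nat.card {p : ι × ι // p.1 ≠ p.2 ∧ ε * K < ‖b p.1 p.2‖} : ℝ)
      / (D * (D - 1))) :
    ∑ n, ∑ m, (if n = m then 0 else ‖c n‖ ^ 2 * ‖c m‖ ^ 2 * ‖b n m‖ ^ 2)
      ≤ K ^ 2 * (ε ^ 2 + (D ^ 2 / Deff) * Real.sqrt Δ) := by
  classical
  let p : ι → ℝ := fun n => ‖c n‖ ^ 2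
  have hp : ∀ n, 0 ≤ p n := fun n => sq_nonneg _
  let B : Finset (ι × ι) :=
    Finset.univ.filter fun x => x.1 ≠ x.2 ∧ ε * K < ‖b x.1 x.2‖
  have hD2 : (2 : ℝ) ≤ D := by rw [hD]; exact_mod_cast hcard
  have hBcard : (B.card : ℝ) = Δ * (D * (D - 1)) := by
    have hne : D * (D - 1) ≠ 0 := by
      apply mul_ne_zero <;> linarith
    rw [hΔ, div_mul_cancel₀ _ hne, Nat.card_eq_fintype_card, Fintype.card_subtype]
  have hΔ0 : 0 ≤ Δ := by
    rw [hΔ]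
    exact div_nonneg (Nat.cast_nonneg _) (mul_nonneg (by linarith) (by linarith))
  have hsqrt : √(B.card : ℝ) ≤ D * √Δ := by
    apply Real.sqrt_le_iff.mpr
    refine ⟨mul_nonneg (by linarith) (Real.sqrt_nonneg _), ?_⟩
    rw [mul_pow, Real.sq_sqrt hΔ0, hBcard]
    nlinarith
  have hS : ∑ n, p n ^ 2 = Deff⁻¹ := by
    rw [hDeff, inv_inv]
    exact Finset.sum_congr rfl fun n _ => by simp only [p]; ring
  have hS0 : 0 ≤ Deff⁻¹ := hS ▸ Finset.sum_nonneg fun n _ => sq_nonneg _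
  have hterm : ∀ n m, (if n = m then 0 else ‖c n‖ ^ 2 * ‖c m‖ ^ 2 * ‖b n m‖ ^ 2)
      ≤ (ε * K) ^ 2 * (p n * p m)
        + D * K ^ 2 * (if (n, m) ∈ B then p n * p m else 0) := by
    intro n m
    have hpp : 0 ≤ p n * p m := mul_nonneg (hp n) (hp m)
    have hDK : 0 ≤ D * K ^ 2 := mul_nonneg (by linarith) (sq_nonneg _)
    by_cases hnm : n = m
    · rw [if_pos hnm]
      split_ifs <;> positivity
    rw [if_neg hnm]
    change p n * p m * ‖b n m‖ ^ 2 ≤ _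
    by_cases hv : ε * K < ‖b n m‖
    · have hmem : (n, m) ∈ B := by simp [B, hnm, hv]
      rw [if_pos hmem]
      have hb2 : ‖b n m‖ ^ 2 ≤ D * K ^ 2 := by
        have h := pow_le_pow_left₀ (norm_nonneg _) (hb n m hnm) 2
        rwa [mul_pow, Real.sq_sqrt (Nat.cast_nonneg _), ← hD] at h
      have := mul_le_mul_of_nonneg_left hb2 hpp
      have := mul_nonneg (sq_nonneg (ε * K)) hpp
      linarith
    · have hmem : (n, m) ∉ B := by simp [B, hv]
      rw [if_neg hmem]
      have := mul_le_mul_of_nonneg_left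
        (pow_le_pow_left₀ (norm_nonneg _) (not_lt.mp hv) 2) hpp
      linarith
  have hpsum : ∑ n, ∑ m, p n * p m = 1 := by
    rw [← Finset.sum_mul_sum, hc, one_mul]
  have hBsum : ∑ n, ∑ m, (if (n, m) ∈ B then p n * p m else 0)
      = ∑ x ∈ B, p x.1 * p x.2 := by
    rw [← Fintype.sum_prod_type' (f := fun n m => if (n, m) ∈ B then p n * p m else 0)]
    simp
  have hBle : ∑ x ∈ B, p x.1 * p x.2 ≤ D * √Δ * Deff⁻¹ := by
    have h := sum_mul_le_sqrt_card_mul_sum_sq p B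
    rw [hS] at h
    exact h.trans (mul_le_mul_of_nonneg_right hsqrt hS0)
  calc _ ≤ ∑ n, ∑ m, ((ε * K) ^ 2 * (p n * p m)
        + D * K ^ 2 * (if (n, m) ∈ B then p n * p m else 0)) :=
        Finset.sum_le_sum fun n _ => Finset.sum_le_sum fun m _ => hterm n m
    _ = (ε * K) ^ 2 + D * K ^ 2 * ∑ x ∈ B, p x.1 * p x.2 := by
        simp only [Finset.sum_add_distrib, ← Finset.mul_sum _ _ ((ε * K) ^ 2),
          ← Finset.mul_sum _ _ (D * K ^ 2)]
        rw [hpsum, hBsum, mul_one]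
    _ ≤ (ε * K) ^ 2 + D * K ^ 2 * (D * √Δ * Deff⁻¹) := by
        have hDK : 0 ≤ D * K ^ 2 := mul_nonneg (by linarith) (sq_nonneg _)
        gcongr
    _ = K ^ 2 * (ε ^ 2 + (D ^ 2 / Deff) * √Δ) := by
        rw [div_eq_mul_inv]
        ring
end

section
/- Let M be a natural number and z a real number with 0 ≤ z ≤ (M+1)·(1 − 1/e). Then Σ_{p=M+1}^∞ z^p / p! ≤ (z·e/(M+1))^{M+1}. -/
/-- Chernoff-type bound for the tail of the exponential series. -/
theorem tsum_pow_div_factorial_tail_le (n : ℕ) (hn : 0 < n) (z : ℝ) (hz0 : 0 ≤ z)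
    (hz : z ≤ n) :
    ∑' k : ℕ, z ^ (n + k) / (Nat.factorial (n + k)) ≤ (z * Real.exp 1 / n) ^ n := by
  have hn' : (0 : ℝ) < n := by exact_mod_cast hn
  have hinj : Function.Injective fun k : ℕ => n + k := add_right_injective n
  have hsum : ∀ x : ℝ, Summable fun k : ℕ => x ^ (n + k) / (Nat.factorial (n + k) : ℝ) :=
    fun x => (Real.summable_pow_div_factorial x).comp_injective hinj
  have hexp : ∑' k : ℕ, (n : ℝ) ^ (n + k) / (Nat.factorial (n + k)) ≤ Real.exp n := by
    rw [Real.exp_eq_exp_ℝ, NormedSpace.exp_eq_tsum_div]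
    exact (hsum n).tsum_le_tsum_of_inj _ hinj (fun _ _ => by positivity) (fun _ => le_rfl)
      (Real.summable_pow_div_factorial n)
  calc ∑' k : ℕ, z ^ (n + k) / (Nat.factorial (n + k))
      ≤ ∑' k : ℕ, (z / n) ^ n * ((n : ℝ) ^ (n + k) / (Nat.factorial (n + k))) := by
        refine (hsum z).tsum_le_tsum (fun k => ?_) ((hsum n).mul_left _)
        rw [← mul_div_assoc]
        gcongr
        calc z ^ (n + k) = (z / n) ^ (n + k) * (n : ℝ) ^ (n + k) := by
              rw [← mul_pow, div_mul_cancel₀ _ hn'.ne']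
          _ ≤ (z / n) ^ n * (n : ℝ) ^ (n + k) := by
              gcongr ?_ * _
              exact pow_le_pow_of_le_one (by positivity) ((div_le_one hn').2 hz)
                (Nat.le_add_right n k)
    _ = (z / n) ^ n * ∑' k : ℕ, (n : ℝ) ^ (n + k) / (Nat.factorial (n + k)) := tsum_mul_left
    _ ≤ (z / n) ^ n * Real.exp n := by gcongr
    _ = (z * Real.exp 1 / n) ^ n := by
        rw [← Real.exp_one_pow, ← mul_pow, div_mul_eq_mul_div]

/-- Tail bound for the exponential series: for `0 ≤ z ≤ (M+1)(1 - 1/e)`,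
`Σ_{p=M+1}^∞ z^p/p! ≤ (z e/(M+1))^{M+1}`. -/
theorem stmt6 (M : ℕ) (z : ℝ) (hz0 : 0 ≤ z)
    (hz : z ≤ ((M : ℝ) + 1) * (1 - 1 / Real.exp 1)) :
    ∑' k : ℕ, z ^ (M + 1 + k) / (Nat.factorial (M + 1 + k)) ≤
      (z * Real.exp 1 / ((M : ℝ) + 1)) ^ (M + 1) := by
  have hle : z ≤ ((M + 1 : ℕ) : ℝ) := by
    push_cast
    refine hz.trans (mul_le_of_le_one_right (by positivity) ?_)
    exact sub_le_self _ (by positivity)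
  exact_mod_cast tsum_pow_div_factorial_tail_le (M + 1) M.succ_pos z hz0 hle
end

section
/- For all natural numbers p ≥ 1 and n with 2n ≤ p, one has the strict inequality (2p)!·(p−1)! < 2^{p+1}·p!·(2n+p−1)!·24^n·n!·2^{p−2n}·(p−2n)!. Equivalently, the Wick-contraction coefficient C^{(2p)}_n := (2p)!/(24^n·n!·2^{p−2n}·(p−2n)!) satisfies C^{(2p)}_n < 2^{p+1}·p!·Γ(2n+p)/Γ(p). -/
theorem Nat.descFactorial_le_ascFactorial (n k : ℕ) : n.descFactorial k ≤ n.ascFactorial k :=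
  (Nat.descFactorial_le_pow n k).trans (Nat.pow_succ_le_ascFactorial n k)

theorem Nat.factorial_mul_factorial_pred_le {p k : ℕ} (hp : 1 ≤ p) (hk : k ≤ p) :
    p.factorial * (p - 1).factorial ≤ (p - k).factorial * (k + p - 1).factorial := by
  have hasc : (p - 1).factorial * p.ascFactorial k = (k + p - 1).factorial := by
    have := Nat.factorial_mul_ascFactorial (p - 1) k
    rwa [Nat.sub_add_cancel hp, show p - 1 + k = k + p - 1 by omega] at this
  rw [← hasc, ← Nat.factorial_mul_descFactorial hk]
  calc _ = (p - k).factorial * (p - 1).factorial * p.descFactorial k := by ring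
    _ ≤ (p - k).factorial * (p - 1).factorial * p.ascFactorial k := by
      gcongr
      exact Nat.descFactorial_le_ascFactorial p k
    _ = _ := by ring

theorem Nat.factorial_two_mul_le_four_pow (p : ℕ) :
    (2 * p).factorial ≤ 4 ^ p * (p.factorial * p.factorial) := by
  have h := Nat.choose_mul_factorial_mul_factorial (show p ≤ 2 * p by omega)
  rw [show 2 * p - p = p by omega, mul_assoc] at h
  rw [← h]
  gcongr
  calc (2 * p).choose p ≤ 2 ^ (2 * p) := Nat.choose_le_two_pow _ _
    _ = 4 ^ p := by rw [pow_mul]; norm_num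

/-- Term-by-term comparison of Wick-contraction coefficients with the sub-Gaussian
moment bound: for `p ≥ 1` and `2n ≤ p`,
`(2p)!·(p-1)! < 2^{p+1}·p!·(2n+p-1)!·24^n·n!·2^{p-2n}·(p-2n)!`. -/
theorem stmt10 (p n : ℕ) (hp : 1 ≤ p) (h : 2 * n ≤ p) :
    Nat.factorial (2 * p) * Nat.factorial (p - 1) <
      2 ^ (p + 1) * Nat.factorial p * Nat.factorial (2 * n + p - 1) * 24 ^ n *
        Nat.factorial n * 2 ^ (p - 2 * n) * Nat.factorial (p - 2 * n) := by
  have hpow : 4 ^ p ≤ 2 ^ p * 24 ^ n * 2 ^ (p - 2 * n) := by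
    calc 4 ^ p = 2 ^ p * 4 ^ n * 2 ^ (p - 2 * n) := by
          rw [show 4 = 2 ^ 2 by norm_num, ← pow_mul, ← pow_mul, ← pow_add, ← pow_add]
          congr 1
          omega
      _ ≤ _ := by gcongr; norm_num
  set A := (p - 2 * n).factorial * (2 * n + p - 1).factorial with hA
  calc (2 * p).factorial * (p - 1).factorial
      ≤ 4 ^ p * (p.factorial * p.factorial) * (p - 1).factorial := by
        gcongr
        exact Nat.factorial_two_mul_le_four_pow p
    _ = 4 ^ p * p.factorial * (p.factorial * (p - 1).factorial) := by ring
    _ ≤ (2 ^ p * 24 ^ n * 2 ^ (p - 2 * n)) * p.factorial * A := by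
        gcongr
        exact Nat.factorial_mul_factorial_pred_le hp h
    _ < 2 * ((2 ^ p * 24 ^ n * 2 ^ (p - 2 * n)) * p.factorial * A) :=
        lt_two_mul_self (by positivity)
    _ ≤ 2 * ((2 ^ p * 24 ^ n * 2 ^ (p - 2 * n)) * p.factorial * A) * n.factorial :=
        Nat.le_mul_of_pos_right _ n.factorial_pos
    _ = _ := by rw [hA]; ring
end

section
/- Let ι be a finite type, w : ι → ℝ with w_n ≥ 0 for all n and Σ_n w_n = 1, Y : ι → ℝ, and p ≥ 1 a natural number. Assume that every odd moment below order 2p vanishes: Σ_n w_n·Y_n^{2k+1} = 0 for every natural number k with 2k+1 < 2p. Then for every real a, Σ_n w_n·Y_n^{2p} ≤ Σ_n w_n·(Y_n + a)^{2p}. -/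
open scoped BigOperators

/-- If all odd moments of `Y` below order `2p` vanish, then for any shift `a`,
`Σ_n w_n Y_n^{2p} ≤ Σ_n w_n (Y_n + a)^{2p}`. -/
theorem stmt19 {ι : Type*} [Fintype ι] (w : ι → ℝ) (hw0 : ∀ n, 0 ≤ w n)
    (hw1 : ∑ n, w n = 1) (Y : ι → ℝ) (p : ℕ) (hp : 1 ≤ p)
    (hodd : ∀ k : ℕ, 2 * k + 1 < 2 * p → ∑ n, w n * Y n ^ (2 * k + 1) = 0) :
    ∀ a : ℝ, ∑ n, w n * Y n ^ (2 * p) ≤ ∑ n, w n * (Y n + a) ^ (2 * p) := by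
  intro a
  have expand : ∑ n, w n * (Y n + a) ^ (2 * p) = ∑ m ∈ Finset.range (2 * p + 1),
      (∑ n, w n * Y n ^ m) * (a ^ (2 * p - m) * (2 * p).choose m) := by
    simp_rw [add_pow, Finset.mul_sum, Finset.sum_mul]
    rw [Finset.sum_comm]
    simp only [mul_assoc]
  rw [expand, Finset.sum_range_succ]
  simp only [Nat.sub_self, pow_zero, Nat.choose_self, Nat.cast_one, mul_one]
  refine le_add_of_nonneg_left (Finset.sum_nonneg fun m hm ↦ ?_)
  rw [Finset.mem_range] at hm
  rcases Nat.even_or_odd m with hm_even | ⟨k, rfl⟩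
  · have ha : Even (2 * p - m) := (Nat.even_sub hm.le).2 (by simp [hm_even])
    exact mul_nonneg
      (Finset.sum_nonneg fun n _ ↦ mul_nonneg (hw0 n) (hm_even.pow_nonneg _))
      (mul_nonneg (ha.pow_nonneg _) (Nat.cast_nonneg _))
  · simp [hodd k hm]
end
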